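/- Fix x ∈ 𝒳 with P(X = x) > 0 and suppose: (Randomization) under P(·|S = e, X = x), D is independent of the pair (Y(0), Y(1)); (Positivity) P(S = e, X = x, D = d, Y = y) > 0 and P(S = o, X = x, Y = y) > 0 for all d, y ∈ {0, 1}; (Stability) R is conditionally independent of S given (X, D, Y); (No direct effect) R is conditionally independent of D given (X, Y). Define Δᵉ := 1{D = 1, S = e}/P(D = 1, S = e | X = x) − 1{D = 0, S = e}/P(D = 0, S = e | X = x), Δᵒ := 1{Y = 1, S = o}/P(Y = 1, S = o | X = x) − 1{Y = 0, S = o}/P(Y = 0, S = o | X = x), and θ(x) := E[Y(1) − Y(0) | S = e, X = x]. Then for every bounded measurable representation H : 𝒳 × ℛ → ℝ with E[H(x, R)·Δᵒ | X = x] ≠ 0, one has θ(x) = E[H(x, R)·Δᵉ | X = x] / E[H(x, R)·Δᵒ | X = x]. -/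

import Mathlib

open MeasureTheory ProbabilityTheory

noncomputable section

/-- Sample indicator values: experimental (`e`) or observational (`o`). -/
inductive Sample : Type
  | e
  | o
deriving DecidableEq

instance : MeasurableSpace Sample := ⊤

/-- Real-valued indicator of a boolean (`{0,1}`-valued variable). -/
def b2r (b : Bool) : ℝ := if b then 1 else 0

/-- `CondIndepOf P R V W` : the conditional law of `R` given `V = v, W = w` agrees with
the conditional law of `R` given `V = v`, for all values with positive probability;
this is the notion of "R is conditionally independent of W given V" for variables with
countable ranges. -/
def CondIndepOf {Ω 𝓡 V W : Type*} [MeasurableSpace Ω] [MeasurableSpace 𝓡]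
    (P : Measure Ω) (R : Ω → 𝓡) (Vf : Ω → V) (Wf : Ω → W) : Prop :=
  ∀ v w, 0 < P {ω | Vf ω = v ∧ Wf ω = w} →
    (P[|{ω | Vf ω = v ∧ Wf ω = w}]).map R = (P[|{ω | Vf ω = v}]).map R

instance : Fintype Sample where
  elems := {Sample.e, Sample.o}
  complete s := by cases s <;> simp

lemma Sample.sum_univ (f : Sample → ℝ) : ∑ s, f s = f Sample.e + f Sample.o :=
  Finset.sum_pair (by decide)

lemma integral_cond_eq_inv_mul {Ω : Type*} [MeasurableSpace Ω] (P : Measure Ω) (A : Set Ω)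
    (f : Ω → ℝ) : ∫ ω, f ω ∂P[|A] = (P.real A)⁻¹ * ∫ ω in A, f ω ∂P := by
  rw [ProbabilityTheory.cond, integral_smul_measure, ENNReal.toReal_inv, smul_eq_mul, Measure.real]

lemma measureReal_cond_eq_inv_mul {Ω : Type*} [MeasurableSpace Ω] {P : Measure Ω} {A : Set Ω}
    (hA : MeasurableSet A) (B : Set Ω) : (P[|A]).real B = (P.real A)⁻¹ * P.real (A ∩ B) := by
  rw [Measure.real, cond_apply hA, ENNReal.toReal_mul, ENNReal.toReal_inv, Measure.real,
    Measure.real]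

lemma integral_mul_comp_eq_sum {Ω τ : Type*} [MeasurableSpace Ω] [Fintype τ] [MeasurableSpace τ]
    [MeasurableSingletonClass τ] {P : Measure Ω} {T : Ω → τ} (hT : Measurable T) {f : Ω → ℝ}
    (hf : Integrable f P) (g : τ → ℝ) :
    ∫ ω, f ω * g (T ω) ∂P = ∑ t, g t * ∫ ω in {ω | T ω = t}, f ω ∂P := by
  classical
  have hm (t : τ) : MeasurableSet {ω | T ω = t} := hT (measurableSet_singleton t)
  have hsum : (fun ω => f ω * g (T ω)) =
      fun ω => ∑ t, {ω | T ω = t}.indicator (fun ω => g t * f ω) ω := by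
    funext ω
    simp [Set.indicator_apply, mul_comm]
  rw [hsum, integral_finsetSum _ fun t _ => (hf.const_mul (g t)).indicator (hm t)]
  simp_rw [integral_indicator (hm _), integral_const_mul]

lemma CondIndepOf.integral_eq {Ω 𝓡 V W : Type*} [MeasurableSpace Ω] [MeasurableSpace 𝓡]
    {P : Measure Ω} {R : Ω → 𝓡} {Vf : Ω → V} {Wf : Ω → W} (h : CondIndepOf P R Vf Wf)
    (hR : Measurable R) {k : 𝓡 → ℝ} (hk : Measurable k) {v : V} {w : W}
    (hpos : 0 < P {ω | Vf ω = v ∧ Wf ω = w}) :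
    ∫ ω, k (R ω) ∂P[|{ω | Vf ω = v ∧ Wf ω = w}] = ∫ ω, k (R ω) ∂P[|{ω | Vf ω = v}] := by
  rw [← integral_map hR.aemeasurable hk.aestronglyMeasurable, h v w hpos,
    integral_map hR.aemeasurable hk.aestronglyMeasurable]

/-- On each cell of `(X, D, Y, S)` the integral of a function of `R` factors through the
conditional mean given `(X, Y)` alone. -/
lemma setIntegral_cell_eq {Ω 𝓡 𝓧 : Type*} [MeasurableSpace Ω] [MeasurableSpace 𝓡]
    {P : Measure Ω} [IsFiniteMeasure P] {S : Ω → Sample} {D Y : Ω → Bool} {R : Ω → 𝓡} {X : Ω → 𝓧}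
    (hR : Measurable R)
    (stability : CondIndepOf P R (fun ω => (X ω, D ω, Y ω)) S)
    (noDirectEffect : CondIndepOf P R (fun ω => (X ω, Y ω)) D)
    {k : 𝓡 → ℝ} (hk : Measurable k) (x : 𝓧) (s : Sample) (d y : Bool) :
    ∫ ω in {ω | S ω = s ∧ X ω = x ∧ D ω = d ∧ Y ω = y}, k (R ω) ∂P =
      P.real {ω | S ω = s ∧ X ω = x ∧ D ω = d ∧ Y ω = y} *
        ∫ ω, k (R ω) ∂P[|{ω | (X ω, Y ω) = (x, y)}] := by
  rcases eq_or_ne (P {ω | S ω = s ∧ X ω = x ∧ D ω = d ∧ Y ω = y}) 0 with h0 | h0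
  · simp [Measure.restrict_eq_zero.2 h0, Measure.real, h0]
  have hcell : {ω | S ω = s ∧ X ω = x ∧ D ω = d ∧ Y ω = y} =
      {ω | (X ω, D ω, Y ω) = (x, d, y) ∧ S ω = s} := by
    ext ω; simp only [Set.mem_ofPred_eq, Prod.mk.injEq]; tauto
  have hmid : {ω | (X ω, D ω, Y ω) = (x, d, y)} = {ω | (X ω, Y ω) = (x, y) ∧ D ω = d} := by
    ext ω; simp only [Set.mem_ofPred_eq, Prod.mk.injEq]; tauto
  have hpos : 0 < P {ω | (X ω, D ω, Y ω) = (x, d, y) ∧ S ω = s} := by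
    rw [← hcell]; exact pos_iff_ne_zero.2 h0
  have hpos' : 0 < P {ω | (X ω, Y ω) = (x, y) ∧ D ω = d} := by
    rw [← hmid]; exact hpos.trans_le (measure_mono fun ω h => h.1)
  rw [← noDirectEffect.integral_eq hR hk hpos', ← hmid, ← stability.integral_eq hR hk hpos,
    ← hcell, integral_cond_eq_inv_mul, mul_inv_cancel_left₀]
  exact (measureReal_ne_zero_iff).2 h0

/-- Under independence of `D` and `Z`, the mean of `Z` is the conditional frequency given `D`. -/
lemma integral_b2r_eq_div {Ω : Type*} [MeasurableSpace Ω] {P : Measure Ω} {D Z : Ω → Bool}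
    (hZ : Measurable Z) (h : IndepFun D Z P) (d : Bool) (hd : P.real {ω | D ω = d} ≠ 0) :
    ∫ ω, b2r (Z ω) ∂P = P.real {ω | D ω = d ∧ Z ω = true} / P.real {ω | D ω = d} := by
  have hInt : ∫ ω, b2r (Z ω) ∂P = P.real {ω | Z ω = true} := by
    rw [show (fun ω => b2r (Z ω)) = {ω | Z ω = true}.indicator 1 by
      ext ω; simp [b2r, Set.indicator_apply], integral_indicator_one]
    exact hZ (measurableSet_singleton true)
  have hprod := h.measure_inter_preimage_eq_mul {d} {true}
    (measurableSet_singleton d) (measurableSet_singleton true)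
  rw [hInt, eq_div_iff hd, mul_comm, Measure.real, Measure.real, Measure.real,
    ← ENNReal.toReal_mul]
  exact congrArg ENNReal.toReal hprod.symm

lemma measureReal_eq_add_bool {Ω : Type*} [MeasurableSpace Ω] (P : Measure Ω) [IsFiniteMeasure P]
    {Z : Ω → Bool} (hZ : Measurable Z) (A : Set Ω) :
    P.real A = P.real (A ∩ {ω | Z ω = true}) + P.real (A ∩ {ω | Z ω = false}) := by
  rw [← measureReal_inter_add_sdiff (s := A) (t := {ω | Z ω = true})
    (hZ (measurableSet_singleton true))]
  congr 2
  ext ω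
  simp

/-- The integral of `k R` against a weight depending on `(S, D, Y)` under `P[|X = x]`, in terms of
cell probabilities and the conditional means given `(X, Y)`. -/
lemma integral_cond_mul_weight_eq_sum {Ω 𝓡 𝓧 : Type*} [MeasurableSpace Ω] [MeasurableSpace 𝓡]
    {P : Measure Ω} [IsFiniteMeasure P] {S : Ω → Sample} {D Y : Ω → Bool} {R : Ω → 𝓡} {X : Ω → 𝓧}
    (hS : Measurable S) (hD : Measurable D) (hY : Measurable Y) (hR : Measurable R)
    (stability : CondIndepOf P R (fun ω => (X ω, D ω, Y ω)) S)
    (noDirectEffect : CondIndepOf P R (fun ω => (X ω, Y ω)) D)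
    {k : 𝓡 → ℝ} (hk : Measurable k) {C : ℝ} (hC : ∀ r, |k r| ≤ C) (x : 𝓧)
    (g : Sample × Bool × Bool → ℝ) :
    ∫ ω, k (R ω) * g (S ω, D ω, Y ω) ∂P[|{ω | X ω = x}] =
      (P.real {ω | X ω = x})⁻¹ * ∑ s, ∑ d, ∑ y, g (s, d, y) *
        (P.real {ω | S ω = s ∧ X ω = x ∧ D ω = d ∧ Y ω = y} *
          ∫ ω, k (R ω) ∂P[|{ω | (X ω, Y ω) = (x, y)}]) := by
  have hT : Measurable fun ω => (S ω, D ω, Y ω) := hS.prodMk (hD.prodMk hY)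
  have hInt : Integrable (fun ω => k (R ω)) (P.restrict {ω | X ω = x}) :=
    Integrable.of_bound (hk.comp hR).aestronglyMeasurable C (ae_of_all _ fun ω => hC _)
  rw [integral_cond_eq_inv_mul, integral_mul_comp_eq_sum hT hInt g]
  simp_rw [Fintype.sum_prod_type]
  congr! 8 with s _ d _ y _
  have hcell : MeasurableSet {ω | (S ω, D ω, Y ω) = (s, d, y)} := hT (measurableSet_singleton _)
  rw [Measure.restrict_restrict hcell,
    ← setIntegral_cell_eq hR stability noDirectEffect hk]
  congr 2
  ext ω
  simp only [Set.mem_inter_iff, Set.mem_ofPred_eq, Prod.mk.injEq]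
  tauto

/-- **Corollary (Identification as representation).**
For any bounded measurable representation `H` with `E[H(x,R)·Δᵒ | X = x] ≠ 0`,
`θ(x) = E[H(x,R)·Δᵉ | X = x] / E[H(x,R)·Δᵒ | X = x]`. -/
theorem statement2
    {Ω 𝓡 𝓧 : Type*} [MeasurableSpace Ω] [MeasurableSpace 𝓡] [StandardBorelSpace 𝓡]
    [MeasurableSpace 𝓧] [MeasurableSingletonClass 𝓧] [Countable 𝓧]
    (P : Measure Ω) [IsProbabilityMeasure P]
    (S : Ω → Sample) (D : Ω → Bool) (Y0 Y1 : Ω → Bool) (R : Ω → 𝓡) (X : Ω → 𝓧)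
    (hS : Measurable S) (hD : Measurable D) (hY0 : Measurable Y0) (hY1 : Measurable Y1)
    (hR : Measurable R) (hX : Measurable X)
    (Y : Ω → Bool) (hYdef : ∀ ω, Y ω = if D ω then Y1 ω else Y0 ω)
    (x : 𝓧) (hx : 0 < P {ω | X ω = x})
    -- Randomization: D ⫫ (Y(0), Y(1)) under P(·|S = e, X = x)
    (randomization :
      IndepFun D (fun ω => (Y0 ω, Y1 ω)) (P[|{ω | S ω = Sample.e ∧ X ω = x}]))
    -- Positivity
    (positivity_e : ∀ d y : Bool,
      0 < P {ω | S ω = Sample.e ∧ X ω = x ∧ D ω = d ∧ Y ω = y})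
    (positivity_o : ∀ y : Bool,
      0 < P {ω | S ω = Sample.o ∧ X ω = x ∧ Y ω = y})
    -- Stability: R ⫫ S | (X, D, Y)
    (stability : CondIndepOf P R (fun ω => (X ω, D ω, Y ω)) S)
    -- No direct effect: R ⫫ D | (X, Y)
    (noDirectEffect : CondIndepOf P R (fun ω => (X ω, Y ω)) D)
    -- θ(x) := E[Y(1) − Y(0) | S = e, X = x]
    (θx : ℝ)
    (hθx : θx = ∫ ω, (b2r (Y1 ω) - b2r (Y0 ω))
        ∂(P[|{ω | S ω = Sample.e ∧ X ω = x}]))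
    -- Δᵉ := 1{D=1,S=e}/P(D=1,S=e|X=x) − 1{D=0,S=e}/P(D=0,S=e|X=x)
    (Δe : Ω → ℝ)
    (hΔe : ∀ ω, Δe ω =
      (if D ω = true ∧ S ω = Sample.e then (1 : ℝ) else 0) /
        ((P[|{ω' | X ω' = x}]) {ω' | D ω' = true ∧ S ω' = Sample.e}).toReal -
      (if D ω = false ∧ S ω = Sample.e then (1 : ℝ) else 0) /
        ((P[|{ω' | X ω' = x}]) {ω' | D ω' = false ∧ S ω' = Sample.e}).toReal)
    -- Δᵒ := 1{Y=1,S=o}/P(Y=1,S=o|X=x) − 1{Y=0,S=o}/P(Y=0,S=o|X=x)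
    (Δo : Ω → ℝ)
    (hΔo : ∀ ω, Δo ω =
      (if Y ω = true ∧ S ω = Sample.o then (1 : ℝ) else 0) /
        ((P[|{ω' | X ω' = x}]) {ω' | Y ω' = true ∧ S ω' = Sample.o}).toReal -
      (if Y ω = false ∧ S ω = Sample.o then (1 : ℝ) else 0) /
        ((P[|{ω' | X ω' = x}]) {ω' | Y ω' = false ∧ S ω' = Sample.o}).toReal) :
    ∀ H : 𝓧 × 𝓡 → ℝ, Measurable H → (∃ C : ℝ, ∀ p, |H p| ≤ C) →
      (∫ ω, H (x, R ω) * Δo ω ∂(P[|{ω | X ω = x}])) ≠ 0 →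
      θx = (∫ ω, H (x, R ω) * Δe ω ∂(P[|{ω | X ω = x}])) /
        (∫ ω, H (x, R ω) * Δo ω ∂(P[|{ω | X ω = x}])) := by
  intro H hH ⟨C, hC⟩ hne
  have hY : Measurable Y := by
    rw [funext hYdef]
    exact Measurable.ite (hD (measurableSet_singleton true)) hY1 hY0
  have hk : Measurable fun r => H (x, r) := hH.comp measurable_prodMk_left
  set p : Sample → Bool → Bool → ℝ := fun s d y =>
    P.real {ω | S ω = s ∧ X ω = x ∧ D ω = d ∧ Y ω = y}
  set c : ℝ := P.real {ω | X ω = x}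
  obtain ⟨μ, key⟩ : ∃ μ : Bool → ℝ, ∀ g : Sample × Bool × Bool → ℝ,
      ∫ ω, H (x, R ω) * g (S ω, D ω, Y ω) ∂P[|{ω | X ω = x}] =
        c⁻¹ * ∑ s, ∑ d, ∑ y, g (s, d, y) * (p s d y * μ y) :=
    ⟨_, integral_cond_mul_weight_eq_sum hS hD hY hR stability noDirectEffect hk
      (fun r => hC (x, r)) x⟩
  have hXm : MeasurableSet {ω | X ω = x} := hX (measurableSet_singleton x)
  have hEm : MeasurableSet {ω | S ω = Sample.e ∧ X ω = x} :=
    (hS (measurableSet_singleton Sample.e)).inter hXm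
  have hcpos : 0 < c := ENNReal.toReal_pos hx.ne' (measure_ne_top _ _)
  have hpe (d y : Bool) : 0 < p Sample.e d y :=
    ENNReal.toReal_pos (positivity_e d y).ne' (measure_ne_top _ _)
  have hDS (d : Bool) : ((P[|{ω | X ω = x}]) {ω | D ω = d ∧ S ω = Sample.e}).toReal =
      c⁻¹ * (p Sample.e d true + p Sample.e d false) := by
    rw [← Measure.real, measureReal_cond_eq_inv_mul hXm, measureReal_eq_add_bool P hY (_ ∩ _)]
    congr! 4 <;> (ext ω; simp only [Set.mem_inter_iff, Set.mem_ofPred_eq]; tauto)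
  have hYS (y : Bool) : ((P[|{ω | X ω = x}]) {ω | Y ω = y ∧ S ω = Sample.o}).toReal =
      c⁻¹ * (p Sample.o true y + p Sample.o false y) := by
    rw [← Measure.real, measureReal_cond_eq_inv_mul hXm, measureReal_eq_add_bool P hD (_ ∩ _)]
    congr! 4 <;> (ext ω; simp only [Set.mem_inter_iff, Set.mem_ofPred_eq]; tauto)
  have hpo (y : Bool) : 0 < p Sample.o true y + p Sample.o false y := by
    have h : P.real {ω | S ω = Sample.o ∧ X ω = x ∧ Y ω = y} =
        p Sample.o true y + p Sample.o false y := by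
      rw [measureReal_eq_add_bool P hD]
      congr! 2 <;> (ext ω; simp only [Set.mem_inter_iff, Set.mem_ofPred_eq]; tauto)
    rw [← h]
    exact ENNReal.toReal_pos (positivity_o y).ne' (measure_ne_top _ _)
  have hnum : ∫ ω, H (x, R ω) * Δe ω ∂(P[|{ω | X ω = x}]) =
      (μ true - μ false) *
        (p Sample.e true true / (p Sample.e true true + p Sample.e true false) -
          p Sample.e false true / (p Sample.e false true + p Sample.e false false)) := by
    have h := key fun t =>
      (if t.2.1 = true ∧ t.1 = Sample.e then (1 : ℝ) else 0) /
        (c⁻¹ * (p Sample.e true true + p Sample.e true false)) -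
      (if t.2.1 = false ∧ t.1 = Sample.e then (1 : ℝ) else 0) /
        (c⁻¹ * (p Sample.e false true + p Sample.e false false))
    simp only [hΔe, hDS]
    rw [h]
    have h1 := (add_pos (hpe true true) (hpe true false)).ne'
    have h2 := (add_pos (hpe false true) (hpe false false)).ne'
    simp only [Sample.sum_univ, Fintype.sum_bool]
    simp
    field_simp
    ring
  have hden : ∫ ω, H (x, R ω) * Δo ω ∂(P[|{ω | X ω = x}]) = μ true - μ false := by
    have h := key fun t =>
      (if t.2.2 = true ∧ t.1 = Sample.o then (1 : ℝ) else 0) /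
        (c⁻¹ * (p Sample.o true true + p Sample.o false true)) -
      (if t.2.2 = false ∧ t.1 = Sample.o then (1 : ℝ) else 0) /
        (c⁻¹ * (p Sample.o true false + p Sample.o false false))
    simp only [hΔo, hYS]
    rw [h]
    have h1 := (hpo true).ne'
    have h2 := (hpo false).ne'
    simp only [Sample.sum_univ, Fintype.sum_bool]
    simp
    field_simp
    ring
  have hEpos : 0 < P.real {ω | S ω = Sample.e ∧ X ω = x} :=
    (hpe true true).trans_le (measureReal_mono fun ω h => ⟨h.1, h.2.1⟩)
  have hED (d : Bool) : (P[|{ω | S ω = Sample.e ∧ X ω = x}]).real {ω | D ω = d} =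
      (P.real {ω | S ω = Sample.e ∧ X ω = x})⁻¹ * (p Sample.e d true + p Sample.e d false) := by
    rw [measureReal_cond_eq_inv_mul hEm, measureReal_eq_add_bool P hY (_ ∩ _)]
    congr! 4 <;> (ext ω; simp only [Set.mem_inter_iff, Set.mem_ofPred_eq]; tauto)
  have hmean (d : Bool) (Z : Ω → Bool) (hZ : Measurable Z)
      (hind : IndepFun D Z (P[|{ω | S ω = Sample.e ∧ X ω = x}]))
      (hcons : ∀ ω, D ω = d → Y ω = Z ω) :
      ∫ ω, b2r (Z ω) ∂(P[|{ω | S ω = Sample.e ∧ X ω = x}]) =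
        p Sample.e d true / (p Sample.e d true + p Sample.e d false) := by
    have hsum := add_pos (hpe d true) (hpe d false)
    have hcell : {ω | S ω = Sample.e ∧ X ω = x} ∩ {ω | D ω = d ∧ Z ω = true} =
        {ω | S ω = Sample.e ∧ X ω = x ∧ D ω = d ∧ Y ω = true} := by
      ext ω
      have := hcons ω
      simp only [Set.mem_inter_iff, Set.mem_ofPred_eq]
      grind
    rw [integral_b2r_eq_div hZ hind d (by rw [hED]; positivity), hED,
      measureReal_cond_eq_inv_mul hEm, hcell,
      mul_div_mul_left _ _ (inv_pos.2 hEpos).ne']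
  have hb (Z : Ω → Bool) (hZ : Measurable Z) :
      Integrable (fun ω => b2r (Z ω)) (P[|{ω | S ω = Sample.e ∧ X ω = x}]) :=
    Integrable.of_bound ((measurable_of_finite b2r).comp hZ).aestronglyMeasurable 1
      (ae_of_all _ fun ω => by cases Z ω <;> simp [b2r])
  have hθ : θx = p Sample.e true true / (p Sample.e true true + p Sample.e true false) -
      p Sample.e false true / (p Sample.e false true + p Sample.e false false) := by
    rw [hθx, integral_sub (hb Y1 hY1) (hb Y0 hY0),
      hmean true Y1 hY1 (randomization.comp measurable_id measurable_snd)
        fun ω h => by simp [hYdef, h],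
      hmean false Y0 hY0 (randomization.comp measurable_id measurable_fst)
        fun ω h => by simp [hYdef, h]]
  rw [hden] at hne
  rw [hnum, hden, hθ, mul_div_cancel_left₀ _ hne]
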